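/- arXiv:2509.06619 — 2 statements merged into one kernel-verified Lean document; each statement's English description precedes it below -/
import Mathlib

section
/- Mean–maximum competitive ratio: Let 0 < μ < β and let 𝒫(μ,β) be the set of Borel probability measures P on ℝ with P([0,β]) = 1 and mean ∫ x dP = μ. Then for every price p ∈ (0,β], inf_{P ∈ 𝒫(μ,β)} CR(p,P) = min{(μ−p)/(β−p), p/β} if p ∈ (0,μ], and inf_{P ∈ 𝒫(μ,β)} CR(p,P) = 0 if p ∈ [μ,β]. -/
open MeasureTheory Set

/-- Tail probability `P(X ≥ p) = P([p,∞))` as a real number. -/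
noncomputable def tail (P : Measure ℝ) (p : ℝ) : ℝ := (P (Ici p)).toReal

/-- Revenue `REV(p,P) = p · P(X ≥ p)`. -/
noncomputable def REV (p : ℝ) (P : Measure ℝ) : ℝ := p * tail P p

/-- Optimal revenue `OPT(P) = sup_{t>0} t · P(X ≥ t)`. -/
noncomputable def OPT (P : Measure ℝ) : ℝ := ⨆ t : Ioi (0:ℝ), (t : ℝ) * tail P (t : ℝ)

/-- Competitive ratio `CR(p,P) = REV(p,P)/OPT(P)`. -/
noncomputable def CR (p : ℝ) (P : Measure ℝ) : ℝ := REV p P / OPT P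

/-- The mean–maximum ambiguity set `𝒫(μ,β)`: Borel probability measures on `ℝ`
supported in `[0,β]` with mean `μ`. -/
def ambMeanMax (μ β : ℝ) : Set (Measure ℝ) :=
  {P | IsProbabilityMeasure P ∧ P (Icc 0 β) = 1 ∧ (∫ x, x ∂P) = μ}

noncomputable def twoPt (a b w : ℝ) : Measure ℝ :=
  ENNReal.ofReal (1 - w) • Measure.dirac a + ENNReal.ofReal w • Measure.dirac b

lemma twoPt_mem (a b w β : ℝ) (ha : 0 ≤ a) (hab : a ≤ b) (hb : b ≤ β) (h0 : 0 ≤ w)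
    (h1 : w ≤ 1) : twoPt a b w ∈ ambMeanMax ((1 - w) * a + w * b) β := by
  have hs : ENNReal.ofReal (1 - w) + ENNReal.ofReal w = 1 := by
    rw [← ENNReal.ofReal_add (by linarith) h0]; simp
  refine ⟨⟨?_⟩, ?_, ?_⟩
  · simp [twoPt, hs]
  · have h1 : a ∈ Icc 0 β := ⟨ha, by linarith⟩
    have h2 : b ∈ Icc 0 β := ⟨by linarith, hb⟩
    simp only [twoPt, Measure.add_apply, Measure.smul_apply, Measure.dirac_apply' _ measurableSet_Icc,
      indicator_of_mem h1, indicator_of_mem h2, smul_eq_mul, Pi.one_apply, mul_one, hs]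
  · unfold twoPt
    rw [integral_add_measure, integral_smul_measure, integral_smul_measure, integral_dirac,
      integral_dirac, ENNReal.toReal_ofReal (by linarith), ENNReal.toReal_ofReal h0]
    · simp
    · exact (integrable_dirac (by simp)).smul_measure (by simp)
    · exact (integrable_dirac (by simp)).smul_measure (by simp)

lemma twoPt_tail_hi (a b w t : ℝ) (h0 : 0 ≤ w) (ha : a < t) (hb : t ≤ b) :
    tail (twoPt a b w) t = w := by
  simp [tail, twoPt, Measure.dirac_apply' _ measurableSet_Ici, indicator, ha, hb, not_le.2 ha, h0]

lemma twoPt_tail_lo (a b w t : ℝ) (h0 : 0 ≤ w) (h1 : w ≤ 1) (ha : t ≤ a) (hb : a ≤ b) :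
    tail (twoPt a b w) t = 1 := by
  have hs : ENNReal.ofReal (1 - w) + ENNReal.ofReal w = 1 := by
    rw [← ENNReal.ofReal_add (by linarith) h0]; simp
  simp [tail, twoPt, Measure.dirac_apply' _ measurableSet_Ici, indicator, ha, ha.trans hb, hs]

lemma twoPt_tail_out (a b w t : ℝ) (ha : a < t) (hb : b < t) :
    tail (twoPt a b w) t = 0 := by
  simp [tail, twoPt, Measure.dirac_apply' _ measurableSet_Ici, indicator, not_le.2 ha, not_le.2 hb]

section
variable {μ β : ℝ} {P : Measure ℝ}

lemma tail_nn (P : Measure ℝ) (t : ℝ) : 0 ≤ tail P t := ENNReal.toReal_nonneg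

lemma tail_le_one (h : P ∈ ambMeanMax μ β) (t : ℝ) : tail P t ≤ 1 := by
  have := h.1
  exact measureReal_le_one

lemma tail_anti (h : P ∈ ambMeanMax μ β) {s t : ℝ} (hst : s ≤ t) : tail P t ≤ tail P s := by
  have := h.1
  exact measureReal_mono (Ici_subset_Ici.2 hst)

lemma ae_mem (h : P ∈ ambMeanMax μ β) : ∀ᵐ x ∂P, x ∈ Icc 0 β := by
  have := h.1
  exact (mem_ae_iff_prob_eq_one measurableSet_Icc).2 h.2.1

lemma tail_out (h : P ∈ ambMeanMax μ β) {t : ℝ} (ht : β < t) : tail P t = 0 := by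
  have : P (Ici t) = 0 := by
    refine measure_mono_null ?_ (ae_iff.1 (ae_mem h))
    intro x hx hx2
    exact absurd (hx2.2) (not_le.2 (lt_of_lt_of_le ht hx))
  simp [tail, this]

lemma bdd (h : P ∈ ambMeanMax μ β) (hβ : 0 < β) :
    BddAbove (range fun t : Ioi (0:ℝ) => (t : ℝ) * tail P (t : ℝ)) := by
  refine ⟨β, ?_⟩
  rintro _ ⟨⟨t, ht⟩, rfl⟩
  have ht : 0 < t := ht
  show t * tail P t ≤ β
  rcases le_or_gt t β with h1 | h1
  · nlinarith [tail_nn P t, tail_le_one h t]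
  · rw [tail_out h h1]; linarith

lemma le_OPT (h : P ∈ ambMeanMax μ β) (hβ : 0 < β) {t : ℝ} (ht : 0 < t) :
    t * tail P t ≤ OPT P :=
  le_ciSup (bdd h hβ) (⟨t, ht⟩ : Ioi (0:ℝ))

lemma OPT_le {c : ℝ} (hc : ∀ t : ℝ, 0 < t → t * tail P t ≤ c) : OPT P ≤ c := by
  have : Nonempty (Ioi (0:ℝ)) := ⟨⟨1, mem_Ioi.2 one_pos⟩⟩
  exact ciSup_le fun t => hc t t.2

lemma CR_nn (h : P ∈ ambMeanMax μ β) (hβ : 0 < β) {p : ℝ} (hp : 0 < p) : 0 ≤ CR p P := by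
  have h1 : 0 ≤ p * tail P p := mul_nonneg hp.le (tail_nn P p)
  exact div_nonneg h1 (h1.trans (le_OPT h hβ hp))

lemma tail_lower (h : P ∈ ambMeanMax μ β) {p : ℝ} (hp : 0 < p) (hpβ : p < β) :
    (μ - p) / (β - p) ≤ tail P p := by
  have := h.1
  rw [div_le_iff₀ (by linarith)]
  have hi : Integrable (fun x : ℝ => x) P := by
    refine Integrable.of_bound (by fun_prop) β ?_
    filter_upwards [ae_mem h] with x hx
    rw [Real.norm_eq_abs, abs_of_nonneg hx.1]; exact hx.2
  have hj : Integrable ((Ici p).indicator (fun _ : ℝ => β - p)) P :=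
    (integrable_const _).indicator measurableSet_Ici
  have := integral_mono_ae hi ((integrable_const p).add hj) (by
    filter_upwards [ae_mem h] with x hx
    simp only [Pi.add_apply, indicator, mem_Ici]
    split_ifs with h1
    · linarith [hx.2]
    · push Not at h1; linarith)
  rw [h.2.2, integral_add' (integrable_const p) hj, integral_indicator measurableSet_Ici] at this
  simp [measureReal_def] at this
  unfold tail
  linarith

lemma CR_lower (h : P ∈ ambMeanMax μ β) {p : ℝ} (hp : 0 < p) (hpμ : p ≤ μ) (hμβ : μ < β) :
    min ((μ - p) / (β - p)) (p / β) ≤ CR p P := by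
  have hβ : 0 < β := by linarith
  rcases hpμ.eq_or_lt with rfl | hlt
  · refine (min_le_left _ _).trans ?_
    simpa using CR_nn h hβ hp
  set m := min ((μ - p) / (β - p)) (p / β) with hm
  have hq := tail_lower h hp (hlt.trans hμβ)
  have hq0 : 0 < (μ - p) / (β - p) := div_pos (by linarith) (by linarith)
  have hm0 : 0 < m := lt_min hq0 (by positivity)
  have hm1 : m ≤ tail P p := (min_le_left _ _).trans hq
  have hm2 : m * β ≤ p := by
    rw [← le_div_iff₀ hβ]; exact min_le_right _ _
  have hO : 0 < OPT P := lt_of_lt_of_le (mul_pos hp (hq0.trans_le hq)) (le_OPT h hβ hp)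
  unfold CR REV
  rw [le_div_iff₀ hO, mul_comm, ← le_div_iff₀ hm0]
  refine OPT_le fun t ht => ?_
  rw [le_div_iff₀ hm0]
  rcases lt_or_ge t p with h1 | h1
  · have : t * tail P t ≤ p := by nlinarith [tail_nn P t, tail_le_one h t]
    exact mul_le_mul this hm1 hm0.le hp.le
  rcases le_or_gt t β with h2 | h2
  · have h3 := tail_anti h h1
    calc t * tail P t * m = (m * t) * tail P t := by ring
      _ ≤ p * tail P p := mul_le_mul ((mul_le_mul_of_nonneg_left h2 hm0.le).trans hm2) h3
          (tail_nn _ _) hp.le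
  · rw [tail_out h h2]; simp; exact mul_nonneg hp.le (tail_nn _ _)
end

lemma upper_a (μ β p : ℝ) (hp : 0 < p) (hpμ : p ≤ μ) (hμβ : μ < β) :
    ∃ P ∈ ambMeanMax μ β, CR p P ≤ p / β := by
  have hβ : 0 < β := by linarith
  have hw : 0 < μ / β := div_pos (by linarith) hβ
  have hw1 : μ / β ≤ 1 := by rw [div_le_one hβ]; exact hμβ.le
  have hmem := twoPt_mem 0 β (μ / β) β le_rfl hβ.le le_rfl hw.le hw1
  have e : (1 - μ / β) * 0 + μ / β * β = μ := by field_simp; ring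
  rw [e] at hmem
  refine ⟨_, hmem, ?_⟩
  have h1 := le_OPT hmem hβ hβ
  rw [twoPt_tail_hi _ _ _ _ hw.le hβ le_rfl] at h1
  unfold CR REV
  rw [twoPt_tail_hi _ _ _ _ hw.le hp (by linarith)]
  rw [div_le_div_iff₀ (lt_of_lt_of_le (by positivity) h1) hβ]
  calc p * (μ / β) * β = p * (β * (μ / β)) := by ring
    _ ≤ _ := mul_le_mul_of_nonneg_left h1 hp.le

lemma upper_b (μ β p a : ℝ) (ha : 0 < a) (hap : a < p) (hpμ : p ≤ μ) (hμβ : μ < β) :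
    ∃ P ∈ ambMeanMax μ β, CR p P ≤ p * ((μ - a) / (β - a)) / a := by
  have hβ : 0 < β := by linarith
  have hab : 0 < β - a := by linarith
  have hw : 0 < (μ - a) / (β - a) := div_pos (by linarith) hab
  have hw1 : (μ - a) / (β - a) ≤ 1 := by rw [div_le_one hab]; linarith
  have hmem := twoPt_mem a β ((μ - a) / (β - a)) β ha.le (by linarith) le_rfl hw.le hw1
  have e : (1 - (μ - a) / (β - a)) * a + (μ - a) / (β - a) * β = μ := by field_simp; ring
  rw [e] at hmem
  refine ⟨_, hmem, ?_⟩
  have h1 := le_OPT hmem hβ ha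
  rw [twoPt_tail_lo _ _ _ _ hw.le hw1 le_rfl (by linarith), mul_one] at h1
  unfold CR REV
  rw [twoPt_tail_hi _ _ _ _ hw.le hap (by linarith)]
  exact div_le_div_of_nonneg_left (mul_nonneg (by linarith) hw.le) ha h1

/-- **Mean–maximum competitive ratio**: the tight lower bound for the competitive
ratio under mean and maximum-valuation information. -/
theorem mean_max_competitive_ratio (μ β : ℝ) (hμ : 0 < μ) (hμβ : μ < β) :
    ∀ p ∈ Ioc (0:ℝ) β,
      (p ≤ μ →
        sInf ((fun P => CR p P) '' ambMeanMax μ β) = min ((μ - p) / (β - p)) (p / β)) ∧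
      (μ ≤ p →
        sInf ((fun P => CR p P) '' ambMeanMax μ β) = 0) := by
  rintro p ⟨hp, hpβ⟩
  have hβ : 0 < β := by linarith
  have hbdd : BddBelow ((fun P => CR p P) '' ambMeanMax μ β) := by
    refine ⟨0, ?_⟩
    rintro _ ⟨P, hP, rfl⟩
    exact CR_nn hP hβ hp
  have first : p ≤ μ →
      sInf ((fun P => CR p P) '' ambMeanMax μ β) = min ((μ - p) / (β - p)) (p / β) := by
    intro hpμ
    obtain ⟨P, hP, hP2⟩ := upper_a μ β p hp hpμ hμβ
    apply le_antisymm
    · refine le_min ?_ ((csInf_le hbdd ⟨P, hP, rfl⟩).trans hP2)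
      have hc : ContinuousAt (fun a : ℝ => p * ((μ - a) / (β - a)) / a) p := by
        have : β - p ≠ 0 := by linarith
        have := hp.ne'
        fun_prop (disch := assumption)
      have ht : Filter.Tendsto (fun a : ℝ => p * ((μ - a) / (β - a)) / a) (nhdsWithin p (Iio p))
          (nhds ((μ - p) / (β - p))) := by
        have := hc.tendsto.mono_left (nhdsWithin_le_nhds (s := Iio p))
        rwa [mul_div_cancel_left₀ _ hp.ne'] at this
      refine ge_of_tendsto ht ?_
      filter_upwards [Ioo_mem_nhdsLT hp] with a ha
      obtain ⟨Q, hQ, hQ2⟩ := upper_b μ β p a ha.1 ha.2 hpμ hμβ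
      exact (csInf_le hbdd ⟨Q, hQ, rfl⟩).trans hQ2
    · refine le_csInf ⟨_, P, hP, rfl⟩ ?_
      rintro _ ⟨Q, hQ, rfl⟩
      exact CR_lower hQ hp hpμ hμβ
  refine ⟨first, fun hμp => ?_⟩
  rcases hμp.eq_or_lt with rfl | hlt
  · rw [first le_rfl]
    simp; positivity
  have hmem := twoPt_mem μ μ 1 β hμ.le le_rfl hμβ.le zero_le_one le_rfl
  have e : (1 - 1) * μ + 1 * μ = μ := by ring
  rw [e] at hmem
  apply le_antisymm
  · refine (csInf_le hbdd ⟨_, hmem, rfl⟩).trans ?_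
    simp [CR, REV, twoPt_tail_out _ _ _ _ hlt hlt]
  · refine le_csInf ⟨_, _, hmem, rfl⟩ ?_
    rintro _ ⟨Q, hQ, rfl⟩
    exact CR_nn hQ hβ hp
end

section
/- Robust worst-case distribution: Fix 0 < μ, β > 0, s > 0 and a strictly convex differentiable dispersion function φ : [0,β] → ℝ≥0, and assume μ ≤ τ₂ < β so that 𝒫 = 𝒫(μ,s,β,φ) is nonempty and nondegenerate. Then for every fixed price p ∈ (0,β] there exists a single sequence of probability measures (P_n)_{n∈ℕ} with P_n ∈ 𝒫 for all n such that simultaneously lim_{n→∞} CR(p,P_n) = inf_{P ∈ 𝒫} CR(p,P) and lim_{n→∞} REV(p,P_n) = inf_{P ∈ 𝒫} REV(p,P); that is, the worst-case objective values for the competitive ratio and for the expected revenue are asymptotically attained by the same worst-case limiting distribution. -/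
open MeasureTheory Set Filter

/-- The ambiguity set `𝒫(μ,s,β,φ)`: Borel probability measures on `ℝ` supported in `[0,β]`,
with mean `μ` and dispersion `∫ φ dP = s`. -/
def amb (μ s β : ℝ) (φ : ℝ → ℝ) : Set (Measure ℝ) :=
  {P | IsProbabilityMeasure P ∧ P (Icc 0 β) = 1 ∧ (∫ x, x ∂P) = μ ∧ (∫ x, φ x ∂P) = s}


lemma amb_ae {μ s β : ℝ} {φ : ℝ → ℝ} {Q : Measure ℝ} (hQ : Q ∈ amb μ s β φ) :
    ∀ᵐ x ∂Q, x ∈ Icc 0 β := by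
  obtain ⟨h1, h2, -, -⟩ := hQ
  exact (prob_compl_eq_zero_iff measurableSet_Icc).2 h2

lemma ae_integrable {β : ℝ} {f : ℝ → ℝ} {Q : Measure ℝ} [IsProbabilityMeasure Q]
    (hQ : ∀ᵐ x ∂Q, x ∈ Icc 0 β) (hf : ContinuousOn f (Icc 0 β)) : Integrable f Q := by
  have h := hf.integrableOn_compact (μ := Q) isCompact_Icc
  rwa [IntegrableOn, Measure.restrict_eq_self_of_ae_mem hQ] at h

lemma amb_shift_le {μ s β : ℝ} {φ : ℝ → ℝ} (c k : ℝ)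
    (hc : ContinuousOn φ (Icc 0 β)) :
    amb μ s β φ ⊆ amb μ (s - c - k * μ) β (fun x => φ x - c - k * x) := by
  intro Q hQ
  have hae := amb_ae hQ
  obtain ⟨h1, h2, h3, h4⟩ := hQ
  refine ⟨h1, h2, h3, ?_⟩
  have i1 := ae_integrable hae hc
  have i2 : Integrable (fun x : ℝ => x) Q := ae_integrable hae continuousOn_id
  have i3 : Integrable (fun x => φ x - c) Q := i1.sub (integrable_const c)
  show ∫ x, (φ x - c - k * x) ∂Q = _
  rw [integral_sub i3 (i2.const_mul k),
    integral_sub i1 (integrable_const c), integral_const_mul, h3, h4]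
  simp

lemma amb_shift {μ s β : ℝ} {φ : ℝ → ℝ} (c k : ℝ)
    (hc : ContinuousOn φ (Icc 0 β)) :
    amb μ s β φ = amb μ (s - c - k * μ) β (fun x => φ x - c - k * x) := by
  apply Subset.antisymm (amb_shift_le c k hc)
  have h := amb_shift_le (μ := μ) (s := s - c - k * μ) (β := β)
    (φ := fun x => φ x - c - k * x) (-c) (-k) (by fun_prop)
  convert h using 2
  · ring
  · ext x; ring

lemma dual {μ β : ℝ} {ψ : ℝ → ℝ} (hc : ContinuousOn ψ (Icc 0 β)) {Q : Measure ℝ}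
    (hQ : Q ∈ amb μ 0 β ψ) (p t c0 c1 c2 e1 e2 : ℝ)
    (h : ∀ x ∈ Icc 0 β, c0 + c1 * x + c2 * ψ x ≤
      e1 * (if p ≤ x then 1 else 0) + e2 * (if t ≤ x then 1 else 0)) :
    c0 + c1 * μ ≤ e1 * tail Q p + e2 * tail Q t := by
  have hae := amb_ae hQ
  obtain ⟨h1, h2, h3, h4⟩ := hQ
  have i1 := ae_integrable hae hc
  have i2 : Integrable (fun x : ℝ => x) Q := ae_integrable hae continuousOn_id
  have ht : ∀ p : ℝ, Integrable (fun x : ℝ => if p ≤ x then (1:ℝ) else 0) Q ∧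
      ∫ x, (if p ≤ x then (1:ℝ) else 0) ∂Q = tail Q p := by
    intro p
    have e : (fun x : ℝ => if p ≤ x then (1:ℝ) else 0) = (Ici p).indicator (fun _ => (1:ℝ)) := by
      ext x; simp [indicator]
    rw [e]
    refine ⟨(integrable_const _).indicator measurableSet_Ici, ?_⟩
    rw [integral_indicator_const _ measurableSet_Ici]
    simp [tail, Measure.real]
  have i3 : Integrable (fun x => c0 + c1 * x) Q := (integrable_const c0).add (i2.const_mul c1)
  have key : ∫ x, (c0 + c1 * x + c2 * ψ x) ∂Q ≤ ∫ x, (e1 * (if p ≤ x then 1 else 0) +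
      e2 * (if t ≤ x then 1 else 0)) ∂Q := integral_mono_ae (μ := Q)
    (i3.add (i1.const_mul c2))
    (((ht p).1.const_mul e1).add ((ht t).1.const_mul e2))
    (by filter_upwards [hae] with x hx using h x hx)
  rw [integral_add i3 (i1.const_mul c2),
    integral_add (integrable_const c0) (i2.const_mul c1),
    integral_add ((ht p).1.const_mul e1) ((ht t).1.const_mul e2),
    integral_const_mul, integral_const_mul, integral_const_mul, integral_const_mul,
    (ht p).2, (ht t).2, h3, h4] at key
  simpa using key

lemma tail_anti_s3 {Q : Measure ℝ} [IsProbabilityMeasure Q] {p t : ℝ} (h : p ≤ t) :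
    tail Q t ≤ tail Q p :=
  ENNReal.toReal_mono (measure_ne_top _ _) (measure_mono (Ici_subset_Ici.2 h))

lemma tail_nonneg (Q : Measure ℝ) (p : ℝ) : 0 ≤ tail Q p := ENNReal.toReal_nonneg

lemma tail_zero {μ s β : ℝ} {φ : ℝ → ℝ} {Q : Measure ℝ} (hQ : Q ∈ amb μ s β φ) {t : ℝ}
    (ht : β < t) : tail Q t = 0 := by
  have : Q (Ici t) = 0 := by
    rw [measure_eq_zero_iff_ae_notMem]
    filter_upwards [amb_ae hQ] with x hx h
    exact absurd (hx.2.trans_lt ht) (not_lt.2 h)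
  simp [tail, this]

lemma markov {μ β : ℝ} {ψ : ℝ → ℝ} (hc : ContinuousOn ψ (Icc 0 β)) {Q : Measure ℝ}
    (hQ : Q ∈ amb μ 0 β ψ) (t : ℝ) : t * tail Q t ≤ μ := by
  have := dual hc hQ t t 0 (-1) 0 (-t) 0 (by
    intro x hx
    have := hx.1
    split_ifs <;> linarith)
  linarith

lemma opt_ge {μ β : ℝ} {ψ : ℝ → ℝ} (hc : ContinuousOn ψ (Icc 0 β)) {Q : Measure ℝ}
    (hQ : Q ∈ amb μ 0 β ψ) {t : ℝ} (ht : 0 < t) : t * tail Q t ≤ OPT Q := by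
  have hb : BddAbove (range fun t : Ioi (0:ℝ) => (t : ℝ) * tail Q (t : ℝ)) := by
    refine ⟨μ, ?_⟩
    rintro _ ⟨t, rfl⟩
    exact markov hc hQ t
  exact le_ciSup hb (⟨t, ht⟩ : Ioi (0:ℝ))

lemma opt_pos {μ β : ℝ} {ψ : ℝ → ℝ} (hμ : 0 < μ) (hβ : 0 < β)
    (hc : ContinuousOn ψ (Icc 0 β)) {Q : Measure ℝ}
    (hQ : Q ∈ amb μ 0 β ψ) : 0 < OPT Q := by
  have h1 := dual hc hQ (μ/2) 0 (-(μ/2)) 1 0 β 0 (by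
    intro x hx
    have := hx.2
    split_ifs <;> linarith)
  have h2 : 0 < tail Q (μ/2) := by
    by_contra h
    nlinarith [tail_nonneg Q (μ/2)]
  have := opt_ge hc hQ (half_pos hμ)
  have : 0 < μ / 2 * tail Q (μ/2) := by positivity
  linarith

/-- three point measure -/
noncomputable def tp (x y a b : ℝ) : Measure ℝ :=
  ENNReal.ofReal (1 - a - b) • Measure.dirac 0 + ENNReal.ofReal a • Measure.dirac x +
    ENNReal.ofReal b • Measure.dirac y

lemma tp_mem {μ β : ℝ} {ψ : ℝ → ℝ} (h0 : ψ 0 = 0) {x y a b : ℝ} (hβ : 0 < β)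
    (hx : x ∈ Icc 0 β) (hy : y ∈ Icc 0 β) (ha : 0 ≤ a) (hb : 0 ≤ b) (hab : a + b ≤ 1)
    (h1 : a * x + b * y = μ) (h2 : a * ψ x + b * ψ y = 0) :
    tp x y a b ∈ amb μ 0 β ψ := by
  have hI : ∀ f : ℝ → ℝ, ∫ z, f z ∂(tp x y a b) = (1 - a - b) * f 0 + a * f x + b * f y := by
    intro f
    have hi : ∀ (c z : ℝ), Integrable f (ENNReal.ofReal c • Measure.dirac z) := fun c z =>
      (integrable_dirac (by simp)).smul_measure ENNReal.ofReal_ne_top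
    rw [tp, integral_add_measure ((hi _ _).add_measure (hi _ _)) (hi _ _),
      integral_add_measure (hi _ _) (hi _ _)]
    simp only [integral_smul_measure, integral_dirac, smul_eq_mul]
    rw [ENNReal.toReal_ofReal (by linarith), ENNReal.toReal_ofReal ha, ENNReal.toReal_ofReal hb]
  have hsum : ENNReal.ofReal (1 - a - b) + ENNReal.ofReal a + ENNReal.ofReal b = 1 := by
    rw [← ENNReal.ofReal_add (by linarith) ha, ← ENNReal.ofReal_add (by linarith) hb]
    rw [show 1 - a - b + a + b = 1 by ring]; simp
  refine ⟨⟨?_⟩, ?_, ?_, ?_⟩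
  · simp [tp, hsum]
  · have : (0:ℝ) ∈ Icc 0 β := ⟨le_rfl, hβ.le⟩
    simp only [tp, Measure.add_apply, Measure.smul_apply, Measure.dirac_apply' _ measurableSet_Icc,
      indicator_of_mem hx, indicator_of_mem hy, indicator_of_mem this]
    simpa using hsum
  · rw [hI]; linarith
  · rw [hI, h0]; linarith

lemma tp_tail {x y a b p : ℝ} (ha : 0 ≤ a) (hb : 0 ≤ b) (hp : 0 < p) :
    tail (tp x y a b) p = (if p ≤ x then a else 0) + (if p ≤ y then b else 0) := by
  simp only [tail, tp, Measure.add_apply, Measure.smul_apply,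
    Measure.dirac_apply' _ measurableSet_Ici, indicator, mem_Ici, not_le.2 hp, if_false]
  split_ifs <;> simp [ENNReal.toReal_add, ha, hb]

lemma core {μ β p : ℝ} {ψ : ℝ → ℝ} (hμ : 0 < μ) (hβ : 0 < β) (hp : 0 < p)
    (hc : ContinuousOn ψ (Icc 0 β)) (h0 : ψ 0 = 0) (x y a b : ℕ → ℝ) (B A C : ℝ)
    (hx : ∀ n, x n ∈ Icc 0 β) (hy : ∀ n, y n ∈ Icc 0 β) (ha : ∀ n, 0 ≤ a n) (hb : ∀ n, 0 ≤ b n)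
    (hab : ∀ n, a n + b n ≤ 1)
    (h1 : ∀ n, a n * x n + b n * y n = μ) (h2 : ∀ n, a n * ψ (x n) + b n * ψ (y n) = 0)
    (hxp : ∀ n, x n < p) (hpy : ∀ n, p ≤ y n)
    (lB : Tendsto b atTop (nhds B)) (lA : Tendsto (fun n => x n * (a n + b n)) atTop (nhds A))
    (lC : Tendsto (fun n => y n * b n) atTop (nhds C))
    (hM : 0 < max A C)
    (hlow : ∀ Q ∈ amb μ 0 β ψ, B ≤ tail Q p ∧
      ∀ t, 0 < t → B * (t * tail Q t) ≤ tail Q p * max A C) :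
    ∃ P : ℕ → Measure ℝ, (∀ n, P n ∈ amb μ 0 β ψ) ∧
        Tendsto (fun n => CR p (P n)) atTop
          (nhds (sInf ((fun Q => CR p Q) '' amb μ 0 β ψ))) ∧
        Tendsto (fun n => REV p (P n)) atTop
          (nhds (sInf ((fun Q => REV p Q) '' amb μ 0 β ψ))) := by
  have hB : 0 ≤ B := ge_of_tendsto' lB hb
  have hmem : ∀ n, tp (x n) (y n) (a n) (b n) ∈ amb μ 0 β ψ := fun n =>
    tp_mem h0 hβ (hx n) (hy n) (ha n) (hb n) (hab n) (h1 n) (h2 n)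
  have htail : ∀ n, tail (tp (x n) (y n) (a n) (b n)) p = b n := fun n => by
    rw [tp_tail (ha n) (hb n) hp]; simp [not_le.2 (hxp n), hpy n]
  have hopt : ∀ n, max (x n * (a n + b n)) (y n * b n) ≤ OPT (tp (x n) (y n) (a n) (b n)) := by
    intro n
    apply max_le
    · rcases (hx n).1.eq_or_lt with h | h
      · have e : x n * (a n + b n) = 0 := by rw [← h, zero_mul]
        rw [e]; exact (opt_pos hμ hβ hc (hmem n)).le
      · have := opt_ge hc (hmem n) h
        rw [tp_tail (ha n) (hb n) h] at this
        simpa [((hxp n).trans_le (hpy n)).le] using this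
    · have hy0 : 0 < y n := hp.trans_le (hpy n)
      have := opt_ge hc (hmem n) hy0
      rw [tp_tail (ha n) (hb n) hy0] at this
      simpa [not_le.2 ((hxp n).trans_le (hpy n))] using this
  have hcrlow : ∀ Q ∈ amb μ 0 β ψ, p * B / max A C ≤ CR p Q := by
    intro Q hQ
    have ho := opt_pos hμ hβ hc hQ
    rw [CR, REV, div_le_div_iff₀ hM ho]
    have : B * OPT Q ≤ tail Q p * max A C := by
      rw [OPT, Real.mul_iSup_of_nonneg hB]
      have : Nonempty (Ioi (0:ℝ)) := ⟨⟨1, by simp⟩⟩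
      exact ciSup_le fun t => (hlow Q hQ).2 t t.2
    nlinarith
  have hrevlow : ∀ Q ∈ amb μ 0 β ψ, p * B ≤ REV p Q := fun Q hQ =>
    mul_le_mul_of_nonneg_left (hlow Q hQ).1 hp.le
  have lrev : Tendsto (fun n => REV p (tp (x n) (y n) (a n) (b n))) atTop (nhds (p * B)) := by
    simp only [REV, htail]
    exact lB.const_mul p
  have lM := lA.max lC
  have lcr : Tendsto (fun n => CR p (tp (x n) (y n) (a n) (b n))) atTop
      (nhds (p * B / max A C)) := by
    refine tendsto_of_tendsto_of_tendsto_of_le_of_le' tendsto_const_nhds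
      ((lB.const_mul p).div lM hM.ne') (Eventually.of_forall fun n => hcrlow _ (hmem n)) ?_
    filter_upwards [lM.eventually (lt_mem_nhds hM)] with n hn
    simp only [CR, REV, htail, Pi.div_apply]
    exact div_le_div_of_nonneg_left (mul_nonneg hp.le (hb n)) hn (hopt n)
  have hinf : ∀ (f : Measure ℝ → ℝ) (v : ℝ), (∀ Q ∈ amb μ 0 β ψ, v ≤ f Q) →
      Tendsto (fun n => f (tp (x n) (y n) (a n) (b n))) atTop (nhds v) →
      sInf (f '' amb μ 0 β ψ) = v := by
    intro f v hv hl
    have hbd : BddBelow (f '' amb μ 0 β ψ) := ⟨v, by rintro _ ⟨Q, hQ, rfl⟩; exact hv Q hQ⟩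
    apply le_antisymm
    · exact ge_of_tendsto' hl fun n => csInf_le hbd ⟨_, hmem n, rfl⟩
    · exact le_csInf ⟨_, _, hmem 0, rfl⟩ (by rintro _ ⟨Q, hQ, rfl⟩; exact hv Q hQ)
  refine ⟨_, hmem, ?_, ?_⟩
  · rw [hinf (fun Q => CR p Q) _ hcrlow lcr]; exact lcr
  · rw [hinf (fun Q => REV p Q) _ hrevlow lrev]; exact lrev

lemma cvx3 {β : ℝ} {ψ : ℝ → ℝ} (h : StrictConvexOn ℝ (Icc 0 β) ψ) {u v w : ℝ} (hu : 0 ≤ u)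
    (huv : u < v) (hvw : v < w) (hw : w ≤ β) :
    (w - u) * ψ v < (w - v) * ψ u + (v - u) * ψ w := by
  have h1 : u ∈ Icc 0 β := ⟨hu, by linarith⟩
  have h2 : w ∈ Icc 0 β := ⟨by linarith, hw⟩
  have hwu : 0 < w - u := by linarith
  have hq1 : 0 < (w - v) / (w - u) := div_pos (by linarith) hwu
  have hq2 : 0 < (v - u) / (w - u) := div_pos (by linarith) hwu
  have hq3 : (w - v) / (w - u) + (v - u) / (w - u) = 1 := by
    rw [← add_div, div_eq_one_iff_eq hwu.ne']; ring
  have := h.2 h1 h2 (by linarith) hq1 hq2 hq3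
  have e : ((w - v) / (w - u)) • u + ((v - u) / (w - u)) • w = v := by
    simp only [smul_eq_mul]; field_simp; ring
  rw [e] at this
  simp only [smul_eq_mul] at this
  have h3 := mul_lt_mul_of_pos_left this hwu
  have e2 : (w - u) * ((w - v) / (w - u) * ψ u + (v - u) / (w - u) * ψ w) =
    (w - v) * ψ u + (v - u) * ψ w := by field_simp
  linarith

lemma subgrad {β : ℝ} {ψ : ℝ → ℝ} (h : StrictConvexOn ℝ (Icc 0 β) ψ)
    (hd : DifferentiableOn ℝ ψ (Icc 0 β)) {z : ℝ} (hz : z ∈ Icc 0 β) :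
    ∃ m : ℝ, ∀ x ∈ Icc 0 β, x ≠ z → ψ z + m * (x - z) < ψ x := by
  have hd' := (hd z hz).hasDerivWithinAt
  refine ⟨derivWithin ψ (Icc 0 β) z, fun x hx hxz => ?_⟩
  rcases lt_or_gt_of_ne hxz with hlt | hlt
  · have := h.slope_lt_of_hasDerivWithinAt hx hz hlt hd'
    rw [slope_def_field, div_lt_iff₀ (by linarith)] at this
    linarith
  · have := h.lt_slope_of_hasDerivWithinAt hz hx hlt hd'
    rw [slope_def_field, lt_div_iff₀ (by linarith)] at this
    linarith

lemma caseC {μ β τ p : ℝ} {ψ : ℝ → ℝ} (hμ : 0 < μ) (hβ : 0 < β)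
    (hc : ContinuousOn ψ (Icc 0 β)) (h0 : ψ 0 = 0) (hτ : ψ τ = 0) (hμτ : μ ≤ τ)
    (hp : τ < p) (hpβ : p ≤ β) :
    ∃ P : ℕ → Measure ℝ, (∀ n, P n ∈ amb μ 0 β ψ) ∧
        Tendsto (fun n => CR p (P n)) atTop
          (nhds (sInf ((fun Q => CR p Q) '' amb μ 0 β ψ))) ∧
        Tendsto (fun n => REV p (P n)) atTop
          (nhds (sInf ((fun Q => REV p Q) '' amb μ 0 β ψ))) := by
  have hτ0 : 0 < τ := by linarith
  have e : μ / τ * τ = μ := by field_simp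
  refine core hμ hβ (by linarith) hc h0 (fun _ => τ) (fun _ => β) (fun _ => μ / τ) (fun _ => 0)
    0 (τ * (μ / τ + 0)) (β * 0) (fun _ => ⟨hτ0.le, by linarith⟩) (fun _ => ⟨hβ.le, le_rfl⟩)
    (fun _ => by positivity) (fun _ => le_rfl) (fun _ => ?_) (fun _ => by linarith)
    (fun _ => by simp [hτ]) (fun _ => hp) (fun _ => hpβ) tendsto_const_nhds tendsto_const_nhds
    tendsto_const_nhds ?_ ?_
  · rw [add_zero, div_le_one hτ0]; exact hμτ
  · apply lt_max_of_lt_left; positivity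
  · intro Q hQ
    refine ⟨tail_nonneg _ _, fun t _ => ?_⟩
    rw [zero_mul]
    refine mul_nonneg (tail_nonneg _ _) (le_max_of_le_left ?_)
    positivity

lemma caseD {μ β p : ℝ} {ψ : ℝ → ℝ} (hμ : 0 < μ) (hβ : 0 < β)
    (hs : StrictConvexOn ℝ (Icc 0 β) ψ) (hd : DifferentiableOn ℝ ψ (Icc 0 β))
    (h0 : ψ 0 = 0) (hτ : ψ μ = 0) (hμβ : μ < β)
    (hp : 0 < p) (hpμ : p ≤ μ) :
    ∃ P : ℕ → Measure ℝ, (∀ n, P n ∈ amb μ 0 β ψ) ∧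
        Tendsto (fun n => CR p (P n)) atTop
          (nhds (sInf ((fun Q => CR p Q) '' amb μ 0 β ψ))) ∧
        Tendsto (fun n => REV p (P n)) atTop
          (nhds (sInf ((fun Q => REV p Q) '' amb μ 0 β ψ))) := by
  have hc := hd.continuousOn
  refine core hμ hβ hp hc h0 (fun _ => 0) (fun _ => μ) (fun _ => 0) (fun _ => 1)
    1 (0 * (0 + 1)) (μ * 1) (fun _ => ⟨le_rfl, hβ.le⟩) (fun _ => ⟨hμ.le, hμβ.le⟩)
    (fun _ => le_rfl) (fun _ => zero_le_one) (fun _ => by norm_num) (fun _ => by ring)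
    (fun _ => by simp [hτ]) (fun _ => hp) (fun _ => hpμ) tendsto_const_nhds tendsto_const_nhds
    tendsto_const_nhds ?_ ?_
  · apply lt_max_of_lt_right; simpa
  · intro Q hQ
    have hmk := markov hc hQ
    have ht : 1 ≤ tail Q p := by
      obtain ⟨m, hm⟩ := subgrad hs hd ⟨hμ.le, hμβ.le⟩
      have hae := amb_ae hQ
      obtain ⟨h1, h2, h3, h4⟩ := hQ
      have i1 := ae_integrable hae hc
      have i2 : Integrable (fun x : ℝ => x) Q := ae_integrable hae continuousOn_id
      have i3 : Integrable (fun x : ℝ => m * (x - μ)) Q :=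
        (i2.sub (integrable_const μ)).const_mul m
      have hz : ∫ x, (ψ x - m * (x - μ)) ∂Q = 0 := by
        rw [integral_sub i1 i3, integral_const_mul, integral_sub i2 (integrable_const μ), h3, h4]
        simp
      have hnn : 0 ≤ᵐ[Q] fun x => ψ x - m * (x - μ) := by
        filter_upwards [hae] with x hx
        by_cases hxm : x = μ
        · simp [hxm, hτ]
        · have := hm x hx hxm
          simp only [Pi.zero_apply]; linarith
      have hz2 := (integral_eq_zero_iff_of_nonneg_ae hnn (i1.sub i3)).1 hz
      have : Q (Ici p) = 1 := by
        rw [← prob_compl_eq_zero_iff measurableSet_Ici]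
        change ∀ᵐ x ∂Q, x ∈ Ici p
        filter_upwards [hae, hz2] with x hx hx2
        by_cases hxm : x = μ
        · rw [hxm]; exact hpμ
        · have := hm x hx hxm
          simp only [Pi.zero_apply] at hx2; linarith
      simp [tail, this]
    refine ⟨ht, fun t _ => ?_⟩
    have h1 := hmk t
    have h2 : μ ≤ max (0 * (0 + 1)) (μ * 1) := le_max_of_le_right (by simp)
    nlinarith [tail_nonneg Q p]

lemma caseA {μ β τ p : ℝ} {ψ : ℝ → ℝ} (hμ : 0 < μ) (hβ : 0 < β)
    (hs : StrictConvexOn ℝ (Icc 0 β) ψ) (hd : DifferentiableOn ℝ ψ (Icc 0 β))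
    (h0 : ψ 0 = 0) (hneg : ∀ x, 0 ≤ x → x ≤ τ → ψ x ≤ 0) (hpos : 0 < ψ β) (hτβ : τ < β)
    (hp : 0 < p) (hpτ : p ≤ τ) (hF : 0 < ψ β * (p - μ) - ψ p * (β - μ)) :
    ∃ P : ℕ → Measure ℝ, (∀ n, P n ∈ amb μ 0 β ψ) ∧
        Tendsto (fun n => CR p (P n)) atTop
          (nhds (sInf ((fun Q => CR p Q) '' amb μ 0 β ψ))) ∧
        Tendsto (fun n => REV p (P n)) atTop
          (nhds (sInf ((fun Q => REV p Q) '' amb μ 0 β ψ))) := by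
  have hc := hd.continuousOn
  obtain ⟨u, -, hu1, hu2⟩ := exists_seq_strictMono_tendsto' hp
  have hpI : p ∈ Icc 0 β := ⟨hp.le, by linarith⟩
  have huI : ∀ n, u n ∈ Icc 0 β := fun n => ⟨(hu1 n).1.le, by linarith [(hu1 n).2]⟩
  have lψ : Tendsto (fun n => ψ (u n)) atTop (nhds (ψ p)) :=
    (hc p hpI).tendsto.comp (tendsto_nhdsWithin_iff.2 ⟨hu2, Eventually.of_forall huI⟩)
  have lF : Tendsto (fun n => ψ β * (u n - μ) - ψ (u n) * (β - μ)) atTop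
      (nhds (ψ β * (p - μ) - ψ p * (β - μ))) :=
    ((hu2.sub_const μ).const_mul _).sub (lψ.mul_const _)
  obtain ⟨N, hN⟩ := eventually_atTop.1 (lF.eventually (lt_mem_nhds hF))
  have hD : ∀ x, 0 < x → x ≤ τ → 0 < ψ β * x - ψ x * β := by
    intro x hx hxτ
    have := hneg x hx.le hxτ
    have : 0 < ψ β * x := mul_pos hpos hx
    nlinarith
  have hsh := tendsto_add_atTop_nat N
  have lx : Tendsto (fun n => u (n + N)) atTop (nhds p) := hu2.comp hsh
  have lψ' : Tendsto (fun n => ψ (u (n + N))) atTop (nhds (ψ p)) := lψ.comp hsh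
  have hxτ : ∀ n, u n ≤ τ := fun n => by linarith [(hu1 n).2]
  have hDn := fun n => hD (u (n + N)) (hu1 _).1 (hxτ _)
  have hDp := hD p hp hpτ
  have lD : Tendsto (fun n => ψ β * u (n + N) - ψ (u (n + N)) * β) atTop
      (nhds (ψ β * p - ψ p * β)) := (lx.const_mul _).sub (lψ'.mul_const _)
  have la : Tendsto (fun n => μ * ψ β / (ψ β * u (n + N) - ψ (u (n + N)) * β)) atTop
      (nhds (μ * ψ β / (ψ β * p - ψ p * β))) := tendsto_const_nhds.div lD hDp.ne'
  have lb : Tendsto (fun n => μ * (-ψ (u (n + N))) / (ψ β * u (n + N) - ψ (u (n + N)) * β)) atTop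
      (nhds (μ * (-ψ p) / (ψ β * p - ψ p * β))) := (lψ'.neg.const_mul μ).div lD hDp.ne'
  have hψp := hneg p hp.le hpτ
  have hb0 : 0 ≤ μ * (-ψ p) / (ψ β * p - ψ p * β) :=
    div_nonneg (mul_nonneg hμ.le (by linarith)) hDp.le
  have ha0 : 0 < μ * ψ β / (ψ β * p - ψ p * β) := div_pos (mul_pos hμ hpos) hDp
  -- chord below p
  have hch : ∀ x, 0 ≤ x → x ≤ p → p * ψ x ≤ x * ψ p := by
    intro x hx hxp
    rcases hx.eq_or_lt with rfl | hx
    · simp [h0]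
    rcases hxp.eq_or_lt with rfl | hxp
    · exact le_rfl
    have := cvx3 hs le_rfl hx hxp hpI.2
    rw [h0] at this; linarith
  -- chord between p and β
  have hch2 : ∀ x, p ≤ x → x ≤ β → (β - p) * ψ x ≤ (β - x) * ψ p + (x - p) * ψ β := by
    intro x hx hxp
    rcases hx.eq_or_lt with rfl | hx
    · linarith
    rcases hxp.eq_or_lt with rfl | hxp
    · linarith
    exact (cvx3 hs hp.le hx hxp le_rfl).le
  have hpβ : 0 < β - p := by linarith
  refine core hμ hβ hp hc h0 (fun n => u (n + N)) (fun _ => β) _ _ _ _ _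
    (fun n => huI _) (fun _ => ⟨hβ.le, le_rfl⟩) (fun n => ?_) (fun n => ?_) (fun n => ?_)
    (fun n => ?_) (fun n => ?_) (fun n => (hu1 _).2) (fun _ => hpI.2) lb (lx.mul (la.add lb))
    (lb.const_mul β) ?_ ?_
  · exact div_nonneg (mul_nonneg hμ.le hpos.le) (hDn n).le
  · exact div_nonneg (mul_nonneg hμ.le (by linarith [hneg _ (huI (n+N)).1 (hxτ _)])) (hDn n).le
  · rw [← add_div, div_le_one (hDn n)]
    have := hN (n + N) (by omega)
    linarith
  · have := (hDn n).ne'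
    field_simp
    ring
  · have := (hDn n).ne'
    field_simp
    ring
  · apply lt_max_of_lt_left
    exact mul_pos hp (by linarith)
  · intro Q hQ
    have := hQ.1
    constructor
    · have := dual hc hQ p 0 0 (-ψ p) p (ψ β * p - ψ p * β) 0 (by
        intro x hx
        split_ifs with h1 h2 h2
        · have h3 := hch2 x h1 hx.2
          have h4 : (β - p) * (p * ψ x - ψ p * x - (ψ β * p - ψ p * β)) ≤ 0 := by
            have h5 := mul_le_mul_of_nonneg_left h3 hp.le
            have h6 : 0 ≤ (β - x) * (ψ β * p - ψ p * β) := mul_nonneg (by linarith [hx.2]) hDp.le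
            nlinarith
          have := nonpos_of_mul_nonpos_right h4 hpβ
          linarith
        · exact absurd hx.1 h2
        · have := hch x hx.1 (not_le.1 h1).le
          linarith
        · exact absurd hx.1 h2)
      rw [div_le_iff₀ hDp]
      linarith
    · intro t ht
      rcases le_or_gt t p with htp | htp
      · have := dual hc hQ p t 0 0 p (p * (ψ β - ψ p)) (ψ p * t) (by
          intro x hx
          split_ifs with h1 h2 h2
          · have h3 := hch2 x h1 hx.2
            have h4 : ψ x ≤ ψ β := by
              have : (β - p) * ψ x ≤ (β - p) * ψ β := by nlinarith [hx.2]
              exact le_of_mul_le_mul_left this hpβ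
            nlinarith
          · linarith
          · have := hch x hx.1 (not_le.1 h1).le
            nlinarith
          · have := hneg x hx.1 (by linarith)
            nlinarith)
        have h5 : -ψ p * (t * tail Q t) ≤ p * (ψ β - ψ p) * tail Q p := by linarith
        refine le_trans ?_ (mul_le_mul_of_nonneg_left (le_max_left _ _) (tail_nonneg Q p))
        rw [← add_div, div_mul_eq_mul_div, ← mul_div_assoc, ← mul_div_assoc]
        apply div_le_div_of_nonneg_right _ hDp.le
        nlinarith
      · refine le_trans ?_ (mul_le_mul_of_nonneg_left (le_max_right _ _) (tail_nonneg Q p))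
        have : t * tail Q t ≤ β * tail Q p := by
          rcases le_or_gt t β with h | h
          · exact mul_le_mul h (tail_anti_s3 htp.le) (tail_nonneg _ _) hβ.le
          · rw [tail_zero hQ h, mul_zero]; exact mul_nonneg hβ.le (tail_nonneg _ _)
        have := mul_le_mul_of_nonneg_left this hb0
        linarith

lemma caseB {μ β τ p : ℝ} {ψ : ℝ → ℝ} (hμ : 0 < μ) (hβ : 0 < β)
    (hs : StrictConvexOn ℝ (Icc 0 β) ψ) (hd : DifferentiableOn ℝ ψ (Icc 0 β))
    (h0 : ψ 0 = 0) (hτ0 : ψ τ = 0) (hneg : ∀ x, 0 ≤ x → x ≤ τ → ψ x ≤ 0) (hneg' : ψ μ < 0)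
    (hpos : 0 < ψ β) (hτβ : τ < β) (hμτ : μ < τ)
    (hp : 0 < p) (hpτ : p ≤ τ) (hF : ψ β * (p - μ) - ψ p * (β - μ) ≤ 0) :
    ∃ P : ℕ → Measure ℝ, (∀ n, P n ∈ amb μ 0 β ψ) ∧
        Tendsto (fun n => CR p (P n)) atTop
          (nhds (sInf ((fun Q => CR p Q) '' amb μ 0 β ψ))) ∧
        Tendsto (fun n => REV p (P n)) atTop
          (nhds (sInf ((fun Q => REV p Q) '' amb μ 0 β ψ))) := by
  have hc := hd.continuousOn
  have hψp := hneg p hp.le hpτ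
  have hpμ : p < μ := by
    by_contra h
    push Not at h
    rcases h.eq_or_lt with rfl | h
    · nlinarith
    · have : 0 < ψ β * (p - μ) := mul_pos hpos (by linarith)
      nlinarith
  have hpI : p ∈ Icc 0 β := ⟨hp.le, by linarith⟩
  -- partner
  have hz : ∀ x, 0 < x → x < p → ∃ z ∈ Icc τ β, ψ z * (x - μ) - ψ x * (z - μ) = 0 := by
    intro x hx hxp
    have hFx : ψ β * (x - μ) - ψ x * (β - μ) ≤ 0 := by
      by_contra hcon
      push Not at hcon
      have h3 := cvx3 hs hx.le hxp hpμ (by linarith)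
      have h4 : (μ - x) * (ψ β * (p - μ) - ψ p * (β - μ)) >
          (μ - p) * (ψ β * (x - μ) - ψ x * (β - μ)) + (p - x) * (-ψ μ * (β - μ)) := by
        nlinarith [mul_lt_mul_of_pos_right h3 (show 0 < β - μ by linarith)]
      have h5 : 0 < (μ - p) * (ψ β * (x - μ) - ψ x * (β - μ)) := mul_pos (by linarith) hcon
      have h6 : 0 < (p - x) * (-ψ μ * (β - μ)) :=
        mul_pos (by linarith) (mul_pos (by linarith) (by linarith))
      have h7 : (μ - x) * (ψ β * (p - μ) - ψ p * (β - μ)) ≤ 0 :=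
        mul_nonpos_of_nonneg_of_nonpos (by linarith) hF
      linarith
    have hcont : ContinuousOn (fun z => ψ z * (x - μ) - ψ x * (z - μ)) (Icc τ β) := by
      have := hc.mono (Icc_subset_Icc_left (show 0 ≤ τ by linarith))
      fun_prop
    have hm : (0:ℝ) ∈ Icc (ψ β * (x - μ) - ψ x * (β - μ)) (ψ τ * (x - μ) - ψ x * (τ - μ)) := by
      refine ⟨hFx, ?_⟩
      have := hneg x hx.le (by linarith)
      rw [hτ0]; nlinarith
    obtain ⟨z, hz, hz2⟩ := intermediate_value_Icc' hτβ.le hcont hm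
    exact ⟨z, hz, hz2⟩
  obtain ⟨u, -, hu1, hu2⟩ := exists_seq_strictMono_tendsto' hp
  choose z' hz'I hz'eq using fun n => hz (u n) (hu1 n).1 (hu1 n).2
  obtain ⟨z, hzI, f, hf, lz⟩ := isCompact_Icc.tendsto_subseq hz'I
  obtain ⟨x, hxdef⟩ : ∃ x : ℕ → ℝ, x = fun n => u (f n) := ⟨_, rfl⟩
  obtain ⟨y, hydef⟩ : ∃ y : ℕ → ℝ, y = fun n => z' (f n) := ⟨_, rfl⟩
  have hx1 : ∀ n, x n ∈ Ioo 0 p := fun n => by rw [hxdef]; exact hu1 _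
  have hy1 : ∀ n, y n ∈ Icc τ β := fun n => by rw [hydef]; exact hz'I _
  have hxy : ∀ n, ψ (y n) * (x n - μ) - ψ (x n) * (y n - μ) = 0 := fun n => by
    rw [hxdef, hydef]; exact hz'eq _
  have lx : Tendsto x atTop (nhds p) := by rw [hxdef]; exact hu2.comp hf.tendsto_atTop
  have ly : Tendsto y atTop (nhds z) := by rw [hydef]; exact lz
  have hxI : ∀ n, x n ∈ Icc 0 β := fun n => ⟨(hx1 n).1.le, by linarith [(hx1 n).2]⟩
  have hyI : ∀ n, y n ∈ Icc 0 β := fun n => ⟨by linarith [(hy1 n).1], (hy1 n).2⟩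
  have hzI' : z ∈ Icc 0 β := ⟨by linarith [hzI.1], hzI.2⟩
  have lψx : Tendsto (fun n => ψ (x n)) atTop (nhds (ψ p)) :=
    (hc p hpI).tendsto.comp (tendsto_nhdsWithin_iff.2 ⟨lx, Eventually.of_forall hxI⟩)
  have lψy : Tendsto (fun n => ψ (y n)) atTop (nhds (ψ z)) :=
    (hc z hzI').tendsto.comp (tendsto_nhdsWithin_iff.2 ⟨ly, Eventually.of_forall hyI⟩)
  have hG : ψ z * (p - μ) - ψ p * (z - μ) = 0 := by
    have l := (lψy.mul (lx.sub_const μ)).sub (lψx.mul (ly.sub_const μ))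
    simp only [hxy] at l
    exact (tendsto_nhds_unique l tendsto_const_nhds)
  have hzτ := hzI.1
  have hzp : 0 < z - p := by linarith
  have hzμ : 0 < z - μ := by linarith
  have lw : Tendsto (fun n => (μ - x n) / (y n - x n)) atTop (nhds ((μ - p) / (z - p))) :=
    (lx.const_sub μ).div (ly.sub lx) hzp.ne'
  have hyx : ∀ n, 0 < y n - x n := fun n => by linarith [(hx1 n).2, (hy1 n).1]
  have hw0 : 0 < (μ - p) / (z - p) := div_pos (by linarith) hzp
  have lA : Tendsto (fun n => x n * ((1 - (μ - x n) / (y n - x n)) + (μ - x n) / (y n - x n)))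
      atTop (nhds p) := by simpa using lx
  refine core hμ hβ hp hc h0 x y (fun n => 1 - (μ - x n) / (y n - x n)) _ _ _ _
    hxI hyI (fun n => ?_) (fun n => ?_) (fun n => ?_)
    (fun n => ?_) (fun n => ?_) (fun n => (hx1 n).2) (fun n => by linarith [(hy1 n).1]) lw lA
    (ly.mul lw) ?_ ?_
  · rw [sub_nonneg, div_le_one (hyx n)]; linarith [(hy1 n).1]
  · exact div_nonneg (by linarith [(hx1 n).2]) (hyx n).le
  · linarith
  · have := (hyx n).ne'
    field_simp
    ring
  · have := (hyx n).ne'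
    have h := hxy n
    field_simp
    linarith
  · exact lt_max_of_lt_left hp
  · intro Q hQ
    have := hQ.1
    obtain ⟨m', hm'⟩ := subgrad hs hd hzI'
    obtain ⟨κ, hκ⟩ : ∃ κ : ℝ, κ = ψ z / (z - μ) := ⟨_, rfl⟩
    have hκz : ψ z = κ * (z - μ) := by rw [hκ]; field_simp
    have hκp : ψ p = κ * (p - μ) := by
      rw [hκ]; field_simp; linarith
    obtain ⟨m, hmdef⟩ : ∃ m : ℝ, m = m' - κ := ⟨_, rfl⟩
    have hm0 : 0 < m := by
      have := hm' p hpI (by linarith)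
      rw [hκz, hκp] at this
      have : 0 < m * (z - p) := by rw [hmdef]; linarith
      exact pos_of_mul_pos_left this hzp.le
    have hsub : ∀ x ∈ Icc 0 β, m * (x - z) ≤ ψ x - κ * (x - μ) := by
      intro x hx
      by_cases hxz : x = z
      · rw [hxz, hκz]; simp
      · have := hm' x hx hxz
        rw [hκz] at this
        rw [hmdef]; linarith
    have hleft : ∀ x, 0 ≤ x → x < p → 0 ≤ ψ x - κ * (x - μ) := by
      intro x hx hxp
      have h3 := cvx3 hs hx hxp (show p < z by linarith) hzI.2
      rw [hκz, hκp] at h3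
      have : 0 ≤ (z - p) * (ψ x - κ * (x - μ)) := by linarith
      exact nonneg_of_mul_nonneg_right this hzp
    have hT := tail_nonneg Q p
    have hlow : (μ - p) / (z - p) ≤ tail Q p := by
      have := dual hc hQ p 0 (-m * p - κ * μ) (m + κ) (-1) (m * (z - p)) 0 (by
        intro x hx
        have h2 := hx.1
        have h3 := hsub x hx
        split_ifs with h1
        · linarith
        · have := hleft x hx.1 (not_le.1 h1)
          nlinarith [not_le.1 h1])
      rw [div_le_iff₀ hzp]
      refine le_of_mul_le_mul_left ?_ hm0
      linarith
    refine ⟨hlow, fun t ht => ?_⟩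
    rcases le_or_gt t p with htp | htp
    · refine le_trans ?_ (mul_le_mul_of_nonneg_left (le_max_left _ _) hT)
      have h1 : tail Q t ≤ 1 := by
        have : Q (Ici t) ≤ 1 := prob_le_one
        exact ENNReal.toReal_le_of_le_ofReal zero_le_one (by simpa using this)
      have h2 : t * tail Q t ≤ p := by nlinarith [tail_nonneg Q t]
      calc _ ≤ (μ - p) / (z - p) * p := mul_le_mul_of_nonneg_left h2 hw0.le
        _ ≤ _ := mul_le_mul_of_nonneg_right hlow hp.le
    · refine le_trans ?_ (mul_le_mul_of_nonneg_left (le_max_right _ _) hT)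
      have h1 : t * tail Q t ≤ z * tail Q p := by
        rcases le_or_gt t z with h | h
        · exact mul_le_mul h (tail_anti_s3 htp.le) (tail_nonneg _ _) (by linarith)
        · have := dual hc hQ p t (-κ * μ) κ (-1) (m * z) (-m * t) (by
            intro x hx
            have h3 := hsub x hx
            split_ifs with h1 h2 h2
            · nlinarith
            · nlinarith
            · linarith
            · have := hleft x hx.1 (not_le.1 h1)
              linarith)
          refine le_of_mul_le_mul_left ?_ hm0
          linarith
      have := mul_le_mul_of_nonneg_left h1 hw0.le
      linarith

lemma main_aux {μ β τ : ℝ} {ψ : ℝ → ℝ} (hμ : 0 < μ) (hβ : 0 < β)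
    (hs : StrictConvexOn ℝ (Icc 0 β) ψ) (hd : DifferentiableOn ℝ ψ (Icc 0 β))
    (h0 : ψ 0 = 0) (hτ0 : ψ τ = 0) (hτβ : τ < β) (hμτ : μ ≤ τ) :
    ∀ p ∈ Ioc (0:ℝ) β,
    ∃ P : ℕ → Measure ℝ, (∀ n, P n ∈ amb μ 0 β ψ) ∧
        Tendsto (fun n => CR p (P n)) atTop
          (nhds (sInf ((fun Q => CR p Q) '' amb μ 0 β ψ))) ∧
        Tendsto (fun n => REV p (P n)) atTop
          (nhds (sInf ((fun Q => REV p Q) '' amb μ 0 β ψ))) := by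
  intro p hp
  rcases lt_or_ge τ p with h | hpτ
  · exact caseC hμ hβ hd.continuousOn h0 hτ0 hμτ h hp.2
  rcases hμτ.eq_or_lt with rfl | hμτ
  · exact caseD hμ hβ hs hd h0 hτ0 hτβ hp.1 hpτ
  have hneg' : ∀ x, 0 < x → x < τ → ψ x < 0 := by
    intro x hx hxτ
    have := cvx3 hs le_rfl hx hxτ hτβ.le
    rw [h0, hτ0] at this
    nlinarith
  have hneg : ∀ x, 0 ≤ x → x ≤ τ → ψ x ≤ 0 := by
    intro x hx hxτ
    rcases hx.eq_or_lt with rfl | hx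
    · exact h0.le
    rcases hxτ.eq_or_lt with rfl | hxτ
    · exact hτ0.le
    exact (hneg' x hx hxτ).le
  have hpos : 0 < ψ β := by
    have := cvx3 hs le_rfl (hμ.trans hμτ) hτβ le_rfl
    rw [h0, hτ0] at this
    nlinarith
  rcases lt_or_ge 0 (ψ β * (p - μ) - ψ p * (β - μ)) with hF | hF
  · exact caseA hμ hβ hs hd h0 hneg hpos hτβ hp.1 hpτ hF
  · exact caseB hμ hβ hs hd h0 hτ0 hneg (hneg' μ hμ hμτ) hpos hτβ hμτ hp.1 hpτ hF

/-- **Robust worst-case distribution** (Theorem 2): for each fixed price `p ∈ (0,β]`,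
the worst-case objective values for the competitive ratio and for the expected revenue
are asymptotically attained by the same sequence of distributions in the ambiguity set. -/
theorem robust_worst_case_distribution
    (μ β s τ₂ : ℝ) (φ : ℝ → ℝ)
    (hμ : 0 < μ) (hβ : 0 < β) (hs : 0 < s)
    (hconv : StrictConvexOn ℝ (Icc 0 β) φ)
    (hdiff : DifferentiableOn ℝ φ (Icc 0 β))
    (hnonneg : ∀ x ∈ Icc (0:ℝ) β, 0 ≤ φ x)
    (hτ₂pos : 0 < τ₂)
    (hτ₂eq : (s - φ 0) / μ = (φ τ₂ - φ 0) / τ₂)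
    (hμτ : μ ≤ τ₂) (hτβ : τ₂ < β) :
    ∀ p ∈ Ioc (0:ℝ) β,
      ∃ P : ℕ → Measure ℝ, (∀ n, P n ∈ amb μ s β φ) ∧
        Tendsto (fun n => CR p (P n)) atTop
          (nhds (sInf ((fun Q => CR p Q) '' amb μ s β φ))) ∧
        Tendsto (fun n => REV p (P n)) atTop
          (nhds (sInf ((fun Q => REV p Q) '' amb μ s β φ))) := by
  obtain ⟨k, hk⟩ : ∃ k : ℝ, k = (s - φ 0) / μ := ⟨_, rfl⟩
  have e1 : s - φ 0 - k * μ = 0 := by rw [hk]; field_simp; ring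
  have e2 : φ τ₂ - φ 0 - k * τ₂ = 0 := by rw [hk, hτ₂eq]; field_simp; ring
  have hA := amb_shift (μ := μ) (s := s) (φ 0) k hdiff.continuousOn
  rw [e1] at hA
  rw [hA]
  refine main_aux hμ hβ ?_ ?_ (by simp) e2 hτβ hμτ
  · refine ⟨hconv.1, fun x hx y hy hxy a b ha hb hab => ?_⟩
    have := hconv.2 hx hy hxy ha hb hab
    simp only [smul_eq_mul] at this ⊢
    have e : φ 0 = a * φ 0 + b * φ 0 := by rw [← add_mul, hab, one_mul]
    linarith
  · fun_prop
end
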